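/- Symbol estimates for the one-step resolvent symbol: let m > 0, δ > 0, c > 0, ħ > 0, Δt > 0, and let f : ℝ^d × ℝ^d → ℂ be smooth with: (a) for every multi-index α there is C_α > 0 with |∂^α f(z)| ≤ C_α (1 + |z|)^{m − |α|} for all z (quasi-polynomial of order m); (b) Re(i f(z)) ≥ δ for all z (quasi-dissipative); (c) |f(z)| ≥ c (1 + |z|)^m for all z (elliptic lower bound). Then g(z) = (1 + (i/ħ) Δt f(z))^{−1} is a well-defined smooth function on ℝ^d × ℝ^d with |g(z)| ≤ 1 for all z, and for every multi-index α ≠ 0 there exists a constant C'_α > 0 (depending on α, m, δ, c, ħ, Δt and the C_β) such that |∂^α g(z)| ≤ C'_α (1 + |z|)^{−m − |α|} for all z. -/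

import Mathlib

open Complex

/-- Symbol estimates of order `k` for derivatives up to order `N`. -/
def SymbolUpTo {E F : Type*} [NormedAddCommGroup E] [NormedSpace ℝ E]
    [NormedAddCommGroup F] [NormedSpace ℝ F] (N : ℕ) (k : ℝ) (u : E → F) : Prop :=
  ∀ n : ℕ, n ≤ N → ∃ C : ℝ, 0 < C ∧
    ∀ z, ‖iteratedFDeriv ℝ n u z‖ ≤ C * (1 + ‖z‖) ^ (k - n)

theorem SymbolUpTo.smul {E F : Type*} [NormedAddCommGroup E] [NormedSpace ℝ E]
    [NormedAddCommGroup F] [NormedSpace ℝ F] [NormedSpace ℂ F] [IsScalarTower ℝ ℂ F]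
    {N : ℕ} {k l : ℝ} {u : E → ℂ} {v : E → F}
    (hu : SymbolUpTo N k u) (hv : SymbolUpTo N l v)
    (hus : ContDiff ℝ (⊤ : ℕ∞) u) (hvs : ContDiff ℝ (⊤ : ℕ∞) v) :
    SymbolUpTo N (k + l) (fun z => u z • v z) := by
  intro n hn
  have hu' : ∀ i : ℕ, ∃ C : ℝ, 0 < C ∧ (i ≤ N →
      ∀ z, ‖iteratedFDeriv ℝ i u z‖ ≤ C * (1 + ‖z‖) ^ (k - i)) := by
    intro i
    by_cases hi : i ≤ N
    · obtain ⟨C, h0, h1⟩ := hu i hi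
      exact ⟨C, h0, fun _ => h1⟩
    · exact ⟨1, one_pos, fun h => absurd h hi⟩
  have hv' : ∀ i : ℕ, ∃ C : ℝ, 0 < C ∧ (i ≤ N →
      ∀ z, ‖iteratedFDeriv ℝ i v z‖ ≤ C * (1 + ‖z‖) ^ (l - i)) := by
    intro i
    by_cases hi : i ≤ N
    · obtain ⟨C, h0, h1⟩ := hv i hi
      exact ⟨C, h0, fun _ => h1⟩
    · exact ⟨1, one_pos, fun h => absurd h hi⟩
  choose A hA0 hA using hu'
  choose B hB0 hB using hv'
  refine ⟨∑ i ∈ Finset.range (n + 1), (n.choose i : ℝ) * A i * B (n - i), ?_, ?_⟩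
  · apply Finset.sum_pos
    · intro i hi
      have : 0 < n.choose i := Nat.choose_pos (by simpa [Nat.lt_succ_iff] using hi)
      have := hA0 i
      have := hB0 (n - i)
      positivity
    · exact ⟨0, by simp⟩
  · intro z
    have hz : 0 < 1 + ‖z‖ := by positivity
    refine (norm_iteratedFDeriv_smul_le hus hvs z
      (n := n) (by exact_mod_cast le_top)).trans ?_
    rw [Finset.sum_mul]
    apply Finset.sum_le_sum
    intro i hi
    have hin : i ≤ n := by simpa [Nat.lt_succ_iff] using hi
    have h1 := hA i (hin.trans hn) z
    have h2 := hB (n - i) ((Nat.sub_le _ _).trans hn) z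
    have e : (1 + ‖z‖) ^ (k + l - n) =
        (1 + ‖z‖) ^ (k - i) * (1 + ‖z‖) ^ (l - ((n - i : ℕ) : ℝ)) := by
      rw [← Real.rpow_add hz, Nat.cast_sub hin]
      congr 1
      ring
    calc (n.choose i : ℝ) * ‖iteratedFDeriv ℝ i u z‖ * ‖iteratedFDeriv ℝ (n - i) v z‖
        ≤ (n.choose i : ℝ) * (A i * (1 + ‖z‖) ^ (k - i)) *
          (B (n - i) * (1 + ‖z‖) ^ (l - ((n - i : ℕ) : ℝ))) := by
          have := hA0 i
          gcongr
      _ = _ := by rw [e]; ring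

/-- Symbol estimates for the one-step resolvent symbol: if `f` is a smooth quasi-polynomial
symbol of order `m` (`‖∂^α f(z)‖ ≤ C_α (1+‖z‖)^{m−|α|}`), quasi-dissipative
(`Re(i f) ≥ δ > 0`), and elliptic from below (`‖f(z)‖ ≥ c (1+‖z‖)^m`), then
`g(z) = (1 + (i/ħ) Δt f(z))⁻¹` is a well-defined smooth function with `‖g‖ ≤ 1` and
`‖∂^α g(z)‖ ≤ C'_α (1+‖z‖)^{−m−|α|}` for every `α ≠ 0`. -/
theorem resolvent_symbol_estimates (d : ℕ) (hd : 1 ≤ d) (m δ c ℏ Δt : ℝ)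
    (hm : 0 < m) (hδ : 0 < δ) (hc : 0 < c) (hℏ : 0 < ℏ) (hΔt : 0 < Δt)
    (f : EuclideanSpace ℝ (Fin d) × EuclideanSpace ℝ (Fin d) → ℂ)
    (hsmooth : ContDiff ℝ (⊤ : ℕ∞) f)
    (hquasipoly : ∀ n : ℕ, ∃ C : ℝ, 0 < C ∧
      ∀ z, ‖iteratedFDeriv ℝ n f z‖ ≤ C * (1 + ‖z‖) ^ (m - n))
    (hdissip : ∀ z, δ ≤ (Complex.I * f z).re)
    (helliptic : ∀ z, c * (1 + ‖z‖) ^ m ≤ ‖f z‖) :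
    (∀ z : EuclideanSpace ℝ (Fin d) × EuclideanSpace ℝ (Fin d),
      (1 : ℂ) + Complex.I / ℏ * Δt * f z ≠ 0) ∧
    ContDiff ℝ (⊤ : ℕ∞) (fun z : EuclideanSpace ℝ (Fin d) × EuclideanSpace ℝ (Fin d) =>
      ((1 : ℂ) + Complex.I / ℏ * Δt * f z)⁻¹) ∧
    (∀ z : EuclideanSpace ℝ (Fin d) × EuclideanSpace ℝ (Fin d),
      ‖((1 : ℂ) + Complex.I / ℏ * Δt * f z)⁻¹‖ ≤ 1) ∧
    ∀ n : ℕ, n ≠ 0 → ∃ C' : ℝ, 0 < C' ∧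
      ∀ z : EuclideanSpace ℝ (Fin d) × EuclideanSpace ℝ (Fin d),
        ‖iteratedFDeriv ℝ n
            (fun w : EuclideanSpace ℝ (Fin d) × EuclideanSpace ℝ (Fin d) =>
              ((1 : ℂ) + Complex.I / ℏ * Δt * f w)⁻¹) z‖
          ≤ C' * (1 + ‖z‖) ^ (-m - n) := by
  set κ : ℂ := Complex.I / ℏ * Δt with hκ
  have hκ' : κ = ((Δt / ℏ : ℝ) : ℂ) * Complex.I := by
    rw [hκ]; push_cast; ring
  have hr : 0 < Δt / ℏ := by positivity
  have hre : ∀ z, 0 < (κ * f z).re := by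
    intro z
    rw [hκ', mul_assoc, Complex.re_ofReal_mul]
    exact mul_pos hr (hδ.trans_le (hdissip z))
  have hge1 : ∀ z, 1 ≤ ‖1 + κ * f z‖ := by
    intro z
    refine le_trans ?_ (Complex.re_le_norm _)
    have := hre z
    rw [Complex.add_re, Complex.one_re]
    linarith
  have hne : ∀ z, 1 + κ * f z ≠ 0 := by
    intro z h
    have := hge1 z
    rw [h, norm_zero] at this
    linarith
  have hκn : ‖κ‖ = Δt / ℏ := by
    rw [hκ', norm_mul, Complex.norm_I, mul_one, Complex.norm_real, Real.norm_of_nonneg hr.le]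
  have hge2 : ∀ z, Δt / ℏ * c * (1 + ‖z‖) ^ m ≤ ‖1 + κ * f z‖ := by
    intro z
    have h1 : ‖κ * f z‖ ≤ ‖1 + κ * f z‖ := by
      have := hre z
      rw [Complex.norm_def, Complex.norm_def]
      apply Real.sqrt_le_sqrt
      simp only [Complex.normSq_apply, Complex.add_re, Complex.add_im, Complex.one_re,
        Complex.one_im]
      nlinarith
    refine le_trans ?_ h1
    rw [norm_mul, hκn, mul_assoc]
    exact mul_le_mul_of_nonneg_left (helliptic z) hr.le
  have hhs : ContDiff ℝ (⊤ : ℕ∞) (fun z => 1 + κ * f z) :=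
    contDiff_const.add (contDiff_const.mul hsmooth)
  have hgs : ContDiff ℝ (⊤ : ℕ∞) (fun z => (1 + κ * f z)⁻¹) := hhs.inv hne
  refine ⟨hne, hgs, ?_, ?_⟩
  · intro z
    rw [norm_inv]
    exact inv_le_one_of_one_le₀ (hge1 z)
  have hfs : ContDiff ℝ (⊤ : ℕ∞) (fderiv ℝ f) := hsmooth.fderiv_right (by simp)
  have hfsym : ∀ N, SymbolUpTo N (m - 1) (fderiv ℝ f) := by
    intro N n _
    obtain ⟨C, h0, h1⟩ := hquasipoly (n + 1)
    refine ⟨C, h0, fun z => ?_⟩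
    rw [norm_iteratedFDeriv_fderiv]
    refine (h1 z).trans_eq ?_
    congr 2
    push_cast
    ring
  have hκsym : ∀ N, SymbolUpTo N 0
      (fun _ : EuclideanSpace ℝ (Fin d) × EuclideanSpace ℝ (Fin d) => -κ) := by
    intro N n _
    refine ⟨‖κ‖ + 1, by positivity, fun z => ?_⟩
    rcases Nat.eq_zero_or_pos n with rfl | hn
    · simp
    · rw [iteratedFDeriv_const_of_ne hn.ne']
      simp only [Pi.zero_apply, norm_zero]
      positivity
  have hfd : fderiv ℝ (fun z => (1 + κ * f z)⁻¹) = fun z =>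
      (-κ) • ((1 + κ * f z)⁻¹ • ((1 + κ * f z)⁻¹ • fderiv ℝ f z)) := by
    funext z
    have hf : HasFDerivAt f (fderiv ℝ f z) z :=
      (hsmooth.differentiable (by simp) z).hasFDerivAt
    have h1 : HasFDerivAt (fun z => 1 + κ * f z) (κ • fderiv ℝ f z) z :=
      (hf.const_mul κ).const_add 1
    have h2 := (hasDerivAt_inv (hne z)).comp_hasFDerivAt z h1
    rw [show (fun z => (1 + κ * f z)⁻¹) = (fun y : ℂ => y⁻¹) ∘ (fun z => 1 + κ * f z) from rfl]
    rw [h2.fderiv]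
    simp only [smul_smul]
    congr 1
    have := hne z
    field_simp
  have hmain : ∀ N, SymbolUpTo N (-m) (fun z => (1 + κ * f z)⁻¹) := by
    intro N
    induction N with
    | zero =>
      intro n hn
      obtain rfl : n = 0 := by omega
      refine ⟨(Δt / ℏ * c)⁻¹, by positivity, fun z => ?_⟩
      have hz : 0 < 1 + ‖z‖ := by positivity
      rw [norm_iteratedFDeriv_zero, norm_inv, Nat.cast_zero, sub_zero, Real.rpow_neg hz.le,
        ← mul_inv]
      exact inv_anti₀ (by positivity) (hge2 z)
    | succ N ih =>
      intro n hn
      rcases n with _ | n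
      · exact ih 0 (Nat.zero_le _)
      · have h1 := (hκsym N).smul (ih.smul (ih.smul (hfsym N) hgs hfs) hgs (hgs.smul hfs))
          contDiff_const (hgs.smul (hgs.smul hfs))
        obtain ⟨C, h0, h2⟩ := h1 n (by omega)
        refine ⟨C, h0, fun z => ?_⟩
        rw [← norm_iteratedFDeriv_fderiv, hfd]
        refine (h2 z).trans_eq ?_
        congr 2
        push_cast
        ring
  intro n _
  exact hmain n n le_rfl
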